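/- Let n₁, n₂ ≥ 1, r ≥ 1 and s ∈ ℕ. Let A be a real n₁×n₁ matrix and C a real n₂×n₂ matrix. Let Ω₁ ⊆ ℝ^{n₁} be open and let V_0, …, V_{r−1} : Ω₁ → ℝ be smooth functions for which there exists a map α : Ω₁ → ℝ^{n₁} such that for all x ∈ Ω₁ the polynomial identity (−A + μI)·(Σ_{j=0}^{r−1} ∇V_j(x)μ^j) = μ^r·α(x) holds in ℝ^{n₁}[μ] (equivalently: A·∇V_0 = 0 and ∇V_{j−1} = A·∇V_j for 1 ≤ j ≤ r−1). Define W_k : ℝ^{n₂} × Ω₁ → ℝ for 0 ≤ k ≤ r+s−1 by W_k(ξ, x) = V_{k−s}(x) if s ≤ k ≤ r+s−1 and W_k = 0 if k < s, and let B be the (n₂+n₁)×(n₂+n₁) block-diagonal matrix B = diag(−C, −A). Then there exists a map β : ℝ^{n₂} × Ω₁ → ℝ^{n₂+n₁} such that (B + μI)·(Σ_{k=0}^{r+s−1} ∇W_k μ^k) = μ^{r+s}·β holds identically, where ∇ denotes the gradient with respect to all n₂+n₁ variables. -/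

import Mathlib

open Polynomial

/-- The gradient of `f` at `x` (vector of partial derivatives), for a general
finite index type of coordinates. -/
noncomputable def grad {ι : Type*} [Fintype ι] [DecidableEq ι]
    (f : (ι → ℝ) → ℝ) (x : ι → ℝ) : ι → ℝ :=
  fun i => fderiv ℝ f x (Pi.single i 1)

theorem grad_pull {n₁ n₂ : ℕ} (f : (Fin n₁ → ℝ) → ℝ) (y : (Fin n₂ ⊕ Fin n₁) → ℝ)
    (hf : DifferentiableAt ℝ f (fun t => y (Sum.inr t))) (j : Fin n₂ ⊕ Fin n₁) :
    grad (fun z : (Fin n₂ ⊕ Fin n₁) → ℝ => f (fun t => z (Sum.inr t))) y j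
      = Sum.elim (fun _ => 0) (grad f (fun t => y (Sum.inr t))) j := by
  let L : ((Fin n₂ ⊕ Fin n₁) → ℝ) →L[ℝ] (Fin n₁ → ℝ) :=
    ContinuousLinearMap.pi fun t => ContinuousLinearMap.proj (Sum.inr t)
  have h : HasFDerivAt (fun z : (Fin n₂ ⊕ Fin n₁) → ℝ => f (fun t => z (Sum.inr t)))
      ((fderiv ℝ f (fun t => y (Sum.inr t))).comp L) y :=
    HasFDerivAt.comp (f := fun z => L z) y hf.hasFDerivAt L.hasFDerivAt
  unfold grad
  rw [h.fderiv]
  cases j with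
  | inl a =>
    have : L (Pi.single (Sum.inl a) 1) = 0 := by
      ext t
      simp [L]
    simp [this]
  | inr a =>
    have : L (Pi.single (Sum.inr a) 1) = Pi.single a 1 := by
      ext t
      simp [L, Pi.single_apply]
    simp [this]

/-- Embedding proposition: a solution `V_μ` of `(−A + μI)∇V_μ ≡ 0 (mod μ^r)` on
`Ω₁ ⊆ ℝ^{n₁}` embeds as the solution `W_μ = μ^s V_μ` (pulled back along the
projection) of the enlarged system `(B + μI)∇W_μ ≡ 0 (mod μ^{r+s})` on
`ℝ^{n₂} × Ω₁`, where `B = diag(−C, −A)`. -/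
theorem stmt_5 (n₁ n₂ : ℕ) (h₁ : 1 ≤ n₁) (h₂ : 1 ≤ n₂) (r : ℕ) (hr : 1 ≤ r) (s : ℕ)
    (A : Matrix (Fin n₁) (Fin n₁) ℝ) (Cm : Matrix (Fin n₂) (Fin n₂) ℝ)
    (Ω₁ : Set (Fin n₁ → ℝ)) (hΩ : IsOpen Ω₁)
    (V : ℕ → ((Fin n₁ → ℝ) → ℝ))
    (hV : ∀ k < r, ContDiffOn ℝ (⊤ : ℕ∞) (V k) Ω₁)
    (α : (Fin n₁ → ℝ) → (Fin n₁ → ℝ))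
    (hsol : ∀ x ∈ Ω₁, ∀ i : Fin n₁,
      (∑ j : Fin n₁, (C ((-A) i j) + if i = j then X else 0) *
          (∑ k ∈ Finset.range r, C (grad (V k) x j) * X ^ k))
        = X ^ r * C (α x i)) :
    ∃ β : ((Fin n₂ ⊕ Fin n₁) → ℝ) → ((Fin n₂ ⊕ Fin n₁) → ℝ),
      ∀ y : (Fin n₂ ⊕ Fin n₁) → ℝ, (fun t => y (Sum.inr t)) ∈ Ω₁ →
        ∀ i : Fin n₂ ⊕ Fin n₁,
          (∑ j : Fin n₂ ⊕ Fin n₁,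
              (C ((Matrix.fromBlocks (-Cm) 0 0 (-A)) i j) + if i = j then X else 0) *
              (∑ k ∈ Finset.range (r + s),
                C (grad (fun z : (Fin n₂ ⊕ Fin n₁) → ℝ =>
                    if s ≤ k then V (k - s) (fun t => z (Sum.inr t)) else 0) y j) * X ^ k))
            = X ^ (r + s) * C (β y i) := by
  refine ⟨fun y => Sum.elim (fun _ => 0) (α (fun t => y (Sum.inr t))), fun y hy i => ?_⟩
  have key : ∀ j : Fin n₂ ⊕ Fin n₁, (∑ k ∈ Finset.range (r + s),
      C (grad (fun z : (Fin n₂ ⊕ Fin n₁) → ℝ =>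
        if s ≤ k then V (k - s) (fun t => z (Sum.inr t)) else 0) y j) * X ^ k)
      = X ^ s * Sum.elim (fun _ => (0 : ℝ[X])) (fun a => ∑ k ∈ Finset.range r,
          C (grad (V k) (fun t => y (Sum.inr t)) a) * X ^ k) j := by
    intro j
    rw [add_comm r s, Finset.sum_range_add, Finset.sum_eq_zero, zero_add]
    · have h : ∀ k ∈ Finset.range r, C (grad (fun z : (Fin n₂ ⊕ Fin n₁) → ℝ =>
          if s ≤ s + k then V (s + k - s) (fun t => z (Sum.inr t)) else 0) y j) * X ^ (s + k)
          = X ^ s * (C (Sum.elim (fun _ => 0) (grad (V k) (fun t => y (Sum.inr t))) j)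
            * X ^ k) := by
        intro k hk
        have hd : DifferentiableAt ℝ (V k) (fun t => y (Sum.inr t)) :=
          ((hV k (Finset.mem_range.1 hk)).contDiffAt (hΩ.mem_nhds hy)).differentiableAt
            (by simp)
        simp only [Nat.le_add_right, if_true, Nat.add_sub_cancel_left]
        rw [grad_pull _ _ hd]
        ring
      rw [Finset.sum_congr rfl h, ← Finset.mul_sum]
      cases j <;> simp
    · intro k hk
      have : ¬ s ≤ k := by simpa using hk
      simp [this, grad]
  simp only [key]
  rw [Fintype.sum_sum_type]
  cases i with
  | inl a => simp
  | inr a =>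
    have := hsol _ hy a
    simp only [Sum.elim_inl, Sum.elim_inr, mul_zero, Finset.sum_const_zero, zero_add,
      Matrix.fromBlocks_apply₂₂, Sum.inr.injEq, mul_left_comm _ (X ^ s : ℝ[X])]
    rw [← Finset.mul_sum, this]
    ring
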